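/- Let E̲ ∈ ℝ, let J be a countable index set with gaps (E_j^-, E_j^+), j ∈ J, pairwise disjoint, E̲ ≤ E_j^-, and suppose Σ_{j∈J} γ_j (1 + η_{j,0}^n) < ∞ for a fixed positive integer n. Then there exists a constant M₃ < ∞ such that for every φ ∈ 𝒟 = (ℝ/2πℤ)^J, every k ∈ J, and every integer m with 1 ≤ m ≤ n, the function t ↦ R_m(φ with the k-th coordinate replaced by t) is differentiable on ℝ/2πℤ and its derivative ∂R_m/∂φ_k satisfies |∂R_m/∂φ_k (φ)| ≤ M₃ (1 + (η_{k,0} + γ_k)^m) γ_k. -/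

import Mathlib

open scoped BigOperators

/-- The Dirichlet eigenvalue `μ_j(φ) = E_j^- + γ_j cos²(φ_j/2)`, written using
`cos²(θ/2) = (1 + cos θ)/2` so that it is well defined on the torus `(ℝ/2πℤ)^J`. -/
noncomputable def gapMu {J : Type*} (Em Ep : J → ℝ) (φ : J → Real.Angle) (j : J) : ℝ :=
  Em j + (Ep j - Em j) * (1 + (φ j).cos) / 2

/-- The scalar field `Q_k(φ) = E̲^k + Σ_j ((E_j^-)^k + (E_j^+)^k − 2 μ_j(φ)^k)`. -/
noncomputable def Qfield {J : Type*} (Ebot : ℝ) (Em Ep : J → ℝ) (k : ℕ)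
    (φ : J → Real.Angle) : ℝ :=
  Ebot ^ k + ∑' j, (Em j ^ k + Ep j ^ k - 2 * gapMu Em Ep φ j ^ k)

/-- The scalar field
`R_m = Σ_{α : Σ k α_k = m} Π_k Q_k^{α_k} / (α_k! (2k)^{α_k})` (so `R_0 = 1`). -/
noncomputable def Rfield {J : Type*} (Ebot : ℝ) (Em Ep : J → ℝ) (m : ℕ)
    (φ : J → Real.Angle) : ℝ :=
  ∑ α ∈ (Fintype.piFinset fun _ : Fin m => Finset.range (m + 1)).filter
      (fun α => ∑ i, (i.1 + 1) * α i = m),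
    ∏ i, Qfield Ebot Em Ep (i.1 + 1) φ ^ α i /
      (((α i).factorial * (2 * (i.1 + 1)) ^ α i : ℕ) : ℝ)

/-- A power of `c + x` is controlled by `1 + x ^ n` for every exponent up to `n`. -/
lemma add_pow_le_mul_one_add_pow {c x : ℝ} (hc : 0 ≤ c) (hx : 0 ≤ x) {l n : ℕ} (hl : l ≤ n) :
    (c + x) ^ l ≤ (2 * (1 + c)) ^ n * (1 + x ^ n) := by
  have h2 : (1 + x) ^ n ≤ 2 ^ n * (1 + x ^ n) := by
    have h := add_pow_le (zero_le_one' ℝ) hx n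
    rw [one_pow] at h
    refine h.trans ?_
    gcongr
    · norm_num
    · omega
  calc (c + x) ^ l ≤ (1 + c + x) ^ l := by gcongr; linarith
    _ ≤ (1 + c + x) ^ n := pow_le_pow_right₀ (by linarith) hl
    _ ≤ ((1 + c) * (1 + x)) ^ n := by gcongr; nlinarith [mul_nonneg hc hx]
    _ = (1 + c) ^ n * (1 + x) ^ n := mul_pow ..
    _ ≤ (1 + c) ^ n * (2 ^ n * (1 + x ^ n)) := by gcongr
    _ = (2 * (1 + c)) ^ n * (1 + x ^ n) := by rw [mul_pow]; ring

/-- The Dirichlet eigenvalue lies in the closed gap. -/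
lemma gapMu_mem_Icc {J : Type*} {Em Ep : J → ℝ} (hlt : ∀ j, Em j < Ep j)
    (φ : J → Real.Angle) (j : J) : gapMu Em Ep φ j ∈ Set.Icc (Em j) (Ep j) := by
  have hj := hlt j
  have h1 : (φ j).cos ≤ 1 := (φ j).induction_on fun x => by simpa using Real.cos_le_one x
  have h2 : -1 ≤ (φ j).cos := (φ j).induction_on fun x => by simpa using Real.neg_one_le_cos x
  unfold gapMu
  constructor <;> nlinarith

lemma abs_le_of_mem_gap {Ebot a b x : ℝ} (hbot : Ebot ≤ a) (hx : x ∈ Set.Icc a b) :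
    |x| ≤ |Ebot| + ((a - Ebot) + (b - a)) := by
  obtain ⟨h1, h2⟩ := hx
  rw [abs_le]
  constructor <;> linarith [neg_abs_le Ebot, le_abs_self Ebot]

lemma abs_pow_sub_pow_le_of_mem_gap {Ebot a b x y : ℝ} (hbot : Ebot ≤ a)
    (hx : x ∈ Set.Icc a b) (hy : y ∈ Set.Icc a b) (i : ℕ) :
    |x ^ i - y ^ i| ≤ (b - a) * i * (|Ebot| + ((a - Ebot) + (b - a))) ^ (i - 1) := by
  have hab : 0 ≤ b - a := by linarith [hx.1, hx.2]
  have hxy : |x - y| ≤ b - a := by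
    rw [abs_le]
    constructor <;> linarith [hx.1, hx.2, hy.1, hy.2]
  refine (abs_pow_sub_pow_le x y i).trans ?_
  gcongr
  exact max_le (abs_le_of_mem_gap hbot hx) (abs_le_of_mem_gap hbot hy)

/-- A summable family, independent of `φ` and `i`, dominating the terms of `Qfield`. -/
lemma exists_summable_bound_Qfield_term {J : Type*} {Ebot : ℝ} {Em Ep : J → ℝ}
    (hlt : ∀ j, Em j < Ep j) (hbot : ∀ j, Ebot ≤ Em j) {n : ℕ}
    (hmom : Summable fun j => (Ep j - Em j) * (1 + (Em j - Ebot) ^ n)) :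
    ∃ u : J → ℝ, Summable u ∧ ∀ φ : J → Real.Angle, ∀ i ≤ n, ∀ j,
      |Em j ^ i + Ep j ^ i - 2 * gapMu Em Ep φ j ^ i| ≤ u j := by
  have hη : ∀ j, 0 ≤ (Em j - Ebot) ^ n := fun j => pow_nonneg (by linarith [hbot j]) n
  have hγ : ∀ j, 0 ≤ Ep j - Em j := fun j => by linarith [hlt j]
  have hterm : ∀ j, 0 ≤ (Ep j - Em j) * (1 + (Em j - Ebot) ^ n) := fun j =>
    mul_nonneg (hγ j) (by linarith [hη j])
  set S := ∑' j, (Ep j - Em j) * (1 + (Em j - Ebot) ^ n) with hS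
  have hS0 : 0 ≤ S := tsum_nonneg hterm
  have hγS : ∀ j, Ep j - Em j ≤ S := fun j =>
    (le_mul_of_one_le_right (hγ j) (by linarith [hη j])).trans
      (hmom.le_tsum j fun i _ => hterm i)
  refine ⟨fun j => 2 * n * (2 * (1 + (|Ebot| + S))) ^ n *
    ((Ep j - Em j) * (1 + (Em j - Ebot) ^ n)), hmom.mul_left _, fun φ i hi j => ?_⟩
  have hμ := gapMu_mem_Icc hlt φ j
  have h1 := abs_pow_sub_pow_le_of_mem_gap (hbot j) (Set.left_mem_Icc.2 (hlt j).le) hμ i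
  have h2 := abs_pow_sub_pow_le_of_mem_gap (hbot j) (Set.right_mem_Icc.2 (hlt j).le) hμ i
  have hx : 0 ≤ Em j - Ebot := by linarith [hbot j]
  have hpow : (|Ebot| + ((Em j - Ebot) + (Ep j - Em j))) ^ (i - 1) ≤
      (2 * (1 + (|Ebot| + S))) ^ n * (1 + (Em j - Ebot) ^ n) := by
    have h := hγ j
    refine le_trans (pow_le_pow_left₀ (by positivity) ?_ _)
      (add_pow_le_mul_one_add_pow (add_nonneg (abs_nonneg Ebot) hS0) hx
        (show i - 1 ≤ n by omega))
    linarith [hγS j]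
  have hbd : (Ep j - Em j) * i * (|Ebot| + ((Em j - Ebot) + (Ep j - Em j))) ^ (i - 1) ≤
      (Ep j - Em j) * n * ((2 * (1 + (|Ebot| + S))) ^ n * (1 + (Em j - Ebot) ^ n)) := by
    have h := hγ j
    have hc : (i : ℝ) ≤ n := by exact_mod_cast hi
    gcongr
  calc |Em j ^ i + Ep j ^ i - 2 * gapMu Em Ep φ j ^ i|
      = |(Em j ^ i - gapMu Em Ep φ j ^ i) + (Ep j ^ i - gapMu Em Ep φ j ^ i)| := by
        congr 1; ring
    _ ≤ _ := abs_add_le _ _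
    _ ≤ _ := add_le_add (h1.trans hbd) (h2.trans hbd)
    _ = _ := by ring

/-- `Qfield` is bounded on the torus, uniformly over the exponents up to `n`. -/
lemma exists_abs_Qfield_le {J : Type*} {Ebot : ℝ} {Em Ep : J → ℝ}
    (hlt : ∀ j, Em j < Ep j) (hbot : ∀ j, Ebot ≤ Em j) {n : ℕ}
    (hmom : Summable fun j => (Ep j - Em j) * (1 + (Em j - Ebot) ^ n)) :
    ∃ B : ℝ, 0 ≤ B ∧ ∀ φ : J → Real.Angle, ∀ i ≤ n, |Qfield Ebot Em Ep i φ| ≤ B := by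
  obtain ⟨u, hu, hbd⟩ := exists_summable_bound_Qfield_term hlt hbot hmom
  have hu0 : ∀ j, 0 ≤ u j := fun j => (abs_nonneg _).trans (hbd 0 0 (Nat.zero_le n) j)
  have hu' : 0 ≤ ∑' j, u j := tsum_nonneg hu0
  refine ⟨(1 + |Ebot|) ^ n + ∑' j, u j, by positivity, fun φ i hi => ?_⟩
  refine (abs_add_le _ _).trans (add_le_add ?_ ?_)
  · rw [abs_pow]
    calc |Ebot| ^ i ≤ (1 + |Ebot|) ^ i := by gcongr; linarith
      _ ≤ _ := pow_le_pow_right₀ (by linarith [abs_nonneg Ebot]) hi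
  · exact tsum_of_norm_bounded (f := fun j => Em j ^ i + Ep j ^ i - 2 * gapMu Em Ep φ j ^ i)
      hu.hasSum (hbd φ i hi)

/-- The derivative of `Qfield` in a single angular coordinate. -/
lemma hasDerivAt_Qfield_update {J : Type*} [DecidableEq J] {Ebot : ℝ} {Em Ep : J → ℝ}
    (hlt : ∀ j, Em j < Ep j) (hbot : ∀ j, Ebot ≤ Em j) {n : ℕ}
    (hmom : Summable fun j => (Ep j - Em j) * (1 + (Em j - Ebot) ^ n))
    (φ : J → Real.Angle) (k : J) {i : ℕ} (hi : i ≤ n) (t : ℝ) :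
    HasDerivAt (fun s : ℝ => Qfield Ebot Em Ep i (Function.update φ k (s : Real.Angle)))
      (i * gapMu Em Ep (Function.update φ k (t : Real.Angle)) k ^ (i - 1) *
        ((Ep k - Em k) * Real.sin t)) t := by
  obtain ⟨u, hu, hbd⟩ := exists_summable_bound_Qfield_term hlt hbot hmom
  have hsum : Summable fun j => Em j ^ i + Ep j ^ i - 2 * gapMu Em Ep φ j ^ i :=
    hu.of_norm_bounded (hbd φ i hi)
  have hμ : ∀ s : ℝ, gapMu Em Ep (Function.update φ k (s : Real.Angle)) k =
      Em k + (Ep k - Em k) * (1 + Real.cos s) / 2 := fun s => by simp [gapMu]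
  have hQ : ∀ s : ℝ, Qfield Ebot Em Ep i (Function.update φ k (s : Real.Angle)) =
      Ebot ^ i + ((Em k ^ i + Ep k ^ i -
        2 * (Em k + (Ep k - Em k) * (1 + Real.cos s) / 2) ^ i) -
        (Em k ^ i + Ep k ^ i - 2 * gapMu Em Ep φ k ^ i) +
        ∑' j, (Em j ^ i + Ep j ^ i - 2 * gapMu Em Ep φ j ^ i)) := fun s => by
    rw [Qfield, ← hμ, ← (hsum.hasSum.update k _).tsum_eq]
    congr 1
    refine tsum_congr fun j => ?_
    rcases eq_or_ne j k with rfl | hj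
    · simp
    · simp [gapMu, hj]
  simp_rw [hQ, hμ]
  have hd : HasDerivAt (fun s : ℝ => Em k + (Ep k - Em k) * (1 + Real.cos s) / 2)
      ((Ep k - Em k) * (-Real.sin t) / 2) t :=
    ((((Real.hasDerivAt_cos t).const_add 1).const_mul _).div_const 2).const_add _
  refine HasDerivAt.congr_deriv ((((((hd.pow i).const_mul 2).const_sub (Em k ^ i + Ep k ^ i)).sub_const
    (Em k ^ i + Ep k ^ i - 2 * gapMu Em Ep φ k ^ i)).add_const
    (∑' j, (Em j ^ i + Ep j ^ i - 2 * gapMu Em Ep φ j ^ i))).const_add (Ebot ^ i)) ?_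
  ring

/-- The chain rule for a continuously differentiable function of finitely many bounded
quantities, with a constant depending only on the function and the bound. -/
lemma ContDiff.exists_hasDerivAt_comp_bound {ι : Type*} [Fintype ι] {P : (ι → ℝ) → ℝ}
    (hP : ContDiff ℝ 1 P) (B : ℝ) (hB : 0 ≤ B) :
    ∃ C : ℝ, 0 ≤ C ∧ ∀ (q : ℝ → ι → ℝ) (q' : ι → ℝ) (t D : ℝ), 0 ≤ D →
      (∀ i, |q t i| ≤ B) → (∀ i, HasDerivAt (fun s => q s i) (q' i) t) → (∀ i, |q' i| ≤ D) →
      ∃ d, HasDerivAt (fun s => P (q s)) d t ∧ |d| ≤ C * D := by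
  obtain ⟨C, hC⟩ := (isCompact_closedBall (0 : ι → ℝ) B).exists_bound_of_continuousOn
    (hP.continuous_fderiv one_ne_zero).continuousOn
  have hC0 : 0 ≤ C := (norm_nonneg _).trans (hC 0 (by simpa using hB))
  refine ⟨C, hC0, fun q q' t D hD hq hq' hD' => ⟨fderiv ℝ P (q t) q', ?_, ?_⟩⟩
  · exact (hP.differentiable one_ne_zero (q t)).hasFDerivAt.comp_hasDerivAt t
      (hasDerivAt_pi.2 hq')
  · have hmem : q t ∈ Metric.closedBall (0 : ι → ℝ) B := by
      rw [mem_closedBall_zero_iff]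
      exact (pi_norm_le_iff_of_nonneg hB).2 hq
    refine ((fderiv ℝ P (q t)).le_opNorm q').trans ?_
    exact mul_le_mul (hC _ hmem) ((pi_norm_le_iff_of_nonneg hD).2 hD') (norm_nonneg _) hC0

/-- The coordinate derivative bound for a single `Rfield`. -/
lemma exists_Rfield_derivative_bound {J : Type*} [DecidableEq J] {Ebot : ℝ} {Em Ep : J → ℝ}
    (hlt : ∀ j, Em j < Ep j) (hbot : ∀ j, Ebot ≤ Em j) {n : ℕ}
    (hmom : Summable fun j => (Ep j - Em j) * (1 + (Em j - Ebot) ^ n)) (m : ℕ) (hm : m ≤ n) :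
    ∃ M : ℝ, ∀ φ : J → Real.Angle, ∀ k : J, ∀ t : ℝ, ∃ d : ℝ,
      HasDerivAt (fun s : ℝ =>
        Rfield Ebot Em Ep m (Function.update φ k (s : Real.Angle))) d t ∧
      |d| ≤ M * (1 + ((Em k - Ebot) + (Ep k - Em k)) ^ m) * (Ep k - Em k) := by
  obtain ⟨B, hB0, hB⟩ := exists_abs_Qfield_le hlt hbot hmom
  have hP : ContDiff ℝ 1 fun q : Fin m → ℝ =>
      ∑ α ∈ (Fintype.piFinset fun _ : Fin m => Finset.range (m + 1)).filter
        (fun α => ∑ i, (i.1 + 1) * α i = m),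
      ∏ i, q i ^ α i / (((α i).factorial * (2 * (i.1 + 1)) ^ α i : ℕ) : ℝ) :=
    ContDiff.sum fun α _ => contDiff_prod fun i _ =>
      ((contDiff_apply ℝ ℝ i).pow (α i)).div_const _
  obtain ⟨C, hC0, hC⟩ := hP.exists_hasDerivAt_comp_bound B hB0
  refine ⟨C * (m * (2 * (1 + |Ebot|)) ^ m), fun φ k t => ?_⟩
  have hγ : 0 ≤ Ep k - Em k := by linarith [hlt k]
  have hη : 0 ≤ Em k - Ebot := by linarith [hbot k]
  have hD : ∀ i : Fin m, |((i.1 + 1 : ℕ) : ℝ) *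
      gapMu Em Ep (Function.update φ k (t : Real.Angle)) k ^ (i.1 + 1 - 1) *
        ((Ep k - Em k) * Real.sin t)| ≤
      m * ((2 * (1 + |Ebot|)) ^ m * (1 + ((Em k - Ebot) + (Ep k - Em k)) ^ m)) *
        (Ep k - Em k) := fun i => by
    have hμ := abs_le_of_mem_gap (hbot k)
      (gapMu_mem_Icc hlt (Function.update φ k (t : Real.Angle)) k)
    have hi : ((i.1 + 1 : ℕ) : ℝ) ≤ m := by exact_mod_cast i.2
    have hpow := (pow_le_pow_left₀ (abs_nonneg _) hμ (i.1 + 1 - 1)).trans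
      (add_pow_le_mul_one_add_pow (abs_nonneg Ebot) (add_nonneg hη hγ)
        (show i.1 + 1 - 1 ≤ m by omega))
    rw [abs_mul, abs_mul, abs_mul, abs_pow, Nat.abs_cast, abs_of_nonneg hγ]
    exact mul_le_mul (mul_le_mul hi hpow (by positivity) (by positivity))
      (mul_le_of_le_one_right hγ (Real.abs_sin_le_one t)) (by positivity) (by positivity)
  obtain ⟨d, hd, hle⟩ := hC
    (fun s i => Qfield Ebot Em Ep (i.1 + 1) (Function.update φ k (s : Real.Angle))) _ t _
    (by positivity) (fun i => hB _ _ (by omega))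
    (fun i => hasDerivAt_Qfield_update hlt hbot hmom φ k (by omega) t) hD
  exact ⟨d, hd, hle.trans_eq (by ring)⟩

/-- Under the moment condition, `R_m` is differentiable in each angular coordinate `φ_k`
with `|∂R_m/∂φ_k| ≤ M₃ (1 + (η_{k,0} + γ_k)^m) γ_k` uniformly on the torus. -/
theorem Rm_coordinate_derivative_bound {J : Type*} [Countable J] [DecidableEq J]
    (Ebot : ℝ) (Em Ep : J → ℝ)
    (hlt : ∀ j, Em j < Ep j) (hbot : ∀ j, Ebot ≤ Em j)
    (hdisj : ∀ i j, i ≠ j → Disjoint (Set.Ioo (Em i) (Ep i)) (Set.Ioo (Em j) (Ep j)))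
    (n : ℕ) (hn : 1 ≤ n)
    (hmom : Summable fun j => (Ep j - Em j) * (1 + (Em j - Ebot) ^ n)) :
    ∃ M₃ : ℝ, ∀ φ : J → Real.Angle, ∀ k : J, ∀ m : ℕ, 1 ≤ m → m ≤ n → ∀ t : ℝ,
      ∃ d : ℝ,
        HasDerivAt (fun s : ℝ =>
          Rfield Ebot Em Ep m (Function.update φ k ((s : Real.Angle)))) d t ∧
        |d| ≤ M₃ * (1 + ((Em k - Ebot) + (Ep k - Em k)) ^ m) * (Ep k - Em k) := by
  choose! M hM using exists_Rfield_derivative_bound hlt hbot hmom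
  obtain ⟨M₃, hM₃⟩ := (Finset.image M (Finset.range (n + 1))).exists_le
  refine ⟨M₃, fun φ k m _ hm t => ?_⟩
  obtain ⟨d, hd, hle⟩ := hM m hm φ k t
  have hγ : 0 ≤ Ep k - Em k := by linarith [hlt k]
  have hη : 0 ≤ Em k - Ebot := by linarith [hbot k]
  refine ⟨d, hd, hle.trans ?_⟩
  gcongr
  exact hM₃ _ (Finset.mem_image_of_mem M (Finset.mem_range.2 (by omega)))
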